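/- arXiv:1409.7969 — 7 statements merged into one kernel-verified Lean document; each statement's English description precedes it below -/
import Mathlib

section
/- If M is a positive integer with M ≡ 3, 5, 6, 7, 8, or 10 (mod 12), then there are no positive integers a and s such that ∑_{i=0}^{M−1} (a+i)² = s²; i.e., the sum of M consecutive squares of positive integers is never a perfect square. -/
theorem jacobiSym_three_eq_neg_one {f : ℕ} (hf : f % 12 = 5 ∨ f % 12 = 7) :
    jacobiSym 3 f = -1 := by
  have hodd : Odd f := Nat.odd_iff.2 (by omega)
  rw [jacobiSym.mod_right 3 hodd]
  rcases hf with h | h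
  · rw [show f % (4 * Int.natAbs 3) = 5 from h]; norm_num
  · rw [show f % (4 * Int.natAbs 3) = 7 from h]; norm_num

theorem not_dvd_three_mul_sq_sub_one {f : ℕ} (hf : f % 12 = 5 ∨ f % 12 = 7) (c : ℤ) :
    ¬ (f : ℤ) ∣ 3 * c ^ 2 - 1 := by
  intro h
  have h1 : jacobiSym (3 * c ^ 2) f = 1 := by
    rw [jacobiSym.mod_left, Int.emod_eq_emod_iff_emod_sub_eq_zero.2 (Int.emod_eq_zero_of_dvd h),
      ← jacobiSym.mod_left, jacobiSym.one_left]
  rw [jacobiSym.mul_left, jacobiSym.pow_left, jacobiSym_three_eq_neg_one hf] at h1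
  nlinarith [sq_nonneg (jacobiSym c f)]

theorem twelve_mul_sum_consecutive_sq (M a : ℕ) :
    (12 : ℤ) * ((∑ i ∈ Finset.range M, (a + i) ^ 2 : ℕ) : ℤ) =
      M * (3 * (2 * a + M - 1) ^ 2 + M ^ 2 - 1) := by
  induction M with
  | zero => simp
  | succ n ih =>
    rw [Finset.sum_range_succ]
    push_cast at ih ⊢
    linear_combination ih

theorem sq_ne_of_squarefree {f : ℕ} (hsf : Squarefree f)
    (hf : f % 12 = 5 ∨ f % 12 = 7) {g M s c : ℤ} (hg : g ∣ 12 ^ 2) (hM : (f : ℤ) ∣ M) :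
    s ^ 2 ≠ f * g * (3 * c ^ 2 + M ^ 2 - 1) := by
  intro h
  have hcop : IsCoprime (f : ℤ) 12 := by
    have : Nat.Coprime f 12 := by
      rw [Nat.Coprime, Nat.gcd_comm, Nat.gcd_rec]
      rcases hf with h | h <;> rw [h] <;> norm_num
    exact_mod_cast Nat.isCoprime_iff_coprime.2 this
  have hf0 : (f : ℤ) ≠ 0 := by
    have : f ≠ 0 := by omega
    exact_mod_cast this
  obtain ⟨r, rfl⟩ : (f : ℤ) ∣ s :=
    ((Int.squarefree_natCast.2 hsf).dvd_pow_iff_dvd two_ne_zero).1 ⟨_, by rw [h, mul_assoc]⟩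
  have hY : (f : ℤ) ∣ 3 * c ^ 2 + M ^ 2 - 1 := by
    refine (hcop.pow_right.of_isCoprime_of_dvd_right hg).dvd_of_dvd_mul_left ⟨r ^ 2, ?_⟩
    refine mul_left_cancel₀ hf0 ?_
    linear_combination -h
  refine not_dvd_three_mul_sq_sub_one hf c ?_
  have := dvd_sub hY (hM.trans (dvd_pow_self M two_ne_zero))
  rwa [show 3 * c ^ 2 + M ^ 2 - 1 - M ^ 2 = 3 * c ^ 2 - 1 by ring] at this

theorem sq_emod_three (x : ℤ) : x ^ 2 % 3 = 0 ∧ x % 3 = 0 ∨ x ^ 2 % 3 = 1 ∧ x % 3 ≠ 0 := by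
  rcases (by omega : x % 3 = 0 ∨ x % 3 = 1 ∨ x % 3 = 2) with h | h | h <;>
    simp [sq, Int.mul_emod, h]

theorem sq_emod_four (x : ℤ) : x ^ 2 % 4 = 0 ∧ x % 2 = 0 ∨ x ^ 2 % 4 = 1 ∧ x % 2 = 1 := by
  rcases Int.even_or_odd' x with ⟨k, rfl | rfl⟩
  · left; ring_nf; omega
  · right; ring_nf; omega

theorem exists_three_mul_sq_eq_of_sq_mul_eq {D e M s Y : ℤ} (hD : D ≠ 0)
    (hM : D ^ 2 * e = M) (h : 12 * s ^ 2 = M * Y) : ∃ q : ℤ, 3 * q ^ 2 = e * Y := by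
  have hdvd : D ^ 2 ∣ (6 * s) ^ 2 := ⟨3 * e * Y, by subst hM; linear_combination 3 * h⟩
  obtain ⟨r, hr⟩ := (Int.pow_dvd_pow_iff two_ne_zero).1 hdvd
  have hr2 : r ^ 2 = 3 * (e * Y) := by
    refine mul_left_cancel₀ (pow_ne_zero 2 hD) ?_
    subst hM
    linear_combination 3 * h - (6 * s + D * r) * hr
  obtain ⟨q, rfl⟩ := Int.prime_three.dvd_of_dvd_pow ⟨_, hr2⟩
  exact ⟨q, by linarith⟩

theorem emod_three_of_sq_mul_eq {D e M : ℤ} (h : D ^ 2 * e = M) (hM : M % 3 ≠ 0) :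
    e % 3 = M % 3 := by
  have hm := Int.mul_emod (D ^ 2) e 3
  rcases sq_emod_three D with hD | hD <;> rw [h, hD.1] at hm <;> omega

theorem emod_four_of_sq_mul_eq {D e M : ℤ} (h : D ^ 2 * e = M) (hM : M % 4 ≠ 0) :
    e % 4 = M % 4 := by
  have hm := Int.mul_emod (D ^ 2) e 4
  rcases sq_emod_four D with hD | hD <;> rw [h, hD.1] at hm <;> omega

theorem emod_three_ne_two_of_sq_eq_mul {q f t : ℤ} (h : q ^ 2 = f * t) (ht : t % 3 = 1) :
    f % 3 ≠ 2 := by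
  have hm := Int.mul_emod f t 3
  have hq := sq_emod_three q
  rw [ht] at hm
  omega

theorem emod_three_ne_one_of_sq_eq_mul {q f t : ℤ} (h : q ^ 2 = f * t) (ht : t % 3 = 2) :
    f % 3 ≠ 1 := by
  have hm := Int.mul_emod f t 3
  have hq := sq_emod_three q
  rw [ht] at hm
  omega

theorem emod_four_eq_of_sq_eq_mul {q f t : ℤ} (h : q ^ 2 = f * t) (hf : f % 2 = 1)
    (ht : t % 2 = 1) : f % 4 = t % 4 := by
  have hm := Int.mul_emod f t 4
  have hq := sq_emod_four q
  rcases (by omega : f % 4 = 1 ∨ f % 4 = 3) with h1 | h1 <;>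
    rcases (by omega : t % 4 = 1 ∨ t % 4 = 3) with h2 | h2 <;>
    rw [h1, h2] at hm <;> omega

theorem three_dvd_of_three_mul_eq_mul {x e t : ℤ} (h : 3 * x = e * t) (ht : t % 3 ≠ 0) :
    3 ∣ e :=
  (Int.prime_three.dvd_or_dvd ⟨x, h.symm⟩).resolve_right (by omega)

theorem not_three_mul_sq_eq_of_odd {e M : ℕ} {q c : ℤ} (he : Squarefree e) (heM : e ∣ M)
    (h4 : e % 4 = M % 4) (h3 : M % 3 ≠ 0 → e % 3 = M % 3)
    (hmod : M % 12 = 3 ∨ M % 12 = 5 ∨ M % 12 = 7) :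
    3 * q ^ 2 ≠ e * (3 * c ^ 2 + (M : ℤ) ^ 2 - 1) := by
  intro hq
  by_cases hM3 : M % 12 = 3
  · have hsq3 : e % 9 ≠ 0 := fun h => by
      have := he 3 (by omega)
      simp at this
    have hY3 : (3 * c ^ 2 + (M : ℤ) ^ 2 - 1) % 3 = 2 := by
      have := sq_emod_three M
      omega
    obtain ⟨f, rfl⟩ : 3 ∣ e := by
      have := three_dvd_of_three_mul_eq_mul hq (by omega)
      omega
    have hfY : q ^ 2 = f * (3 * c ^ 2 + (M : ℤ) ^ 2 - 1) := by
      push_cast at hq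
      linarith
    have hf3 := emod_three_ne_one_of_sq_eq_mul hfY hY3
    refine sq_ne_of_squarefree (he.squarefree_of_dvd ⟨3, mul_comm 3 f⟩) (by omega)
      (g := 1) (s := q) (c := c) (by norm_num)
      (Int.natCast_dvd_natCast.2 ((Dvd.intro_left 3 rfl).trans heM)) ?_
    linear_combination hfY
  · refine sq_ne_of_squarefree he (by omega) (g := 3) (s := 3 * q) (c := c)
      (by norm_num) (Int.natCast_dvd_natCast.2 heM) ?_
    linear_combination 3 * hq

theorem not_three_mul_sq_eq_of_even {e M : ℕ} {q c : ℤ} (he : Squarefree e) (heM : e ∣ M)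
    (h3 : M % 3 ≠ 0 → e % 3 = M % 3) (hc : c % 2 = 1)
    (hmod : M % 12 = 6 ∨ M % 12 = 8 ∨ M % 12 = 10) :
    3 * q ^ 2 ≠ e * (3 * c ^ 2 + (M : ℤ) ^ 2 - 1) := by
  intro hq
  obtain ⟨t, ht, ht3, ht4⟩ : ∃ t : ℤ, 3 * c ^ 2 + (M : ℤ) ^ 2 - 1 = 2 * t ∧
      (M % 12 = 6 → t % 3 = 1) ∧
      (t % 4 = 1 ∧ M % 4 = 0 ∨ t % 4 = 3 ∧ M % 4 = 2) := by
    obtain ⟨N, rfl⟩ : 2 ∣ M := by omega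
    have hc1 := Int.eight_dvd_sq_sub_one_of_odd (Int.odd_iff.2 hc)
    have hN := sq_emod_four N
    have hN3 := sq_emod_three N
    have hMN : ((2 * N : ℕ) : ℤ) ^ 2 = 4 * (N : ℤ) ^ 2 := by push_cast; ring
    rw [hMN]
    exact ⟨(3 * c ^ 2 + 4 * (N : ℤ) ^ 2 - 1) / 2, by omega, by omega, by omega⟩
  have hsq2 : e % 4 ≠ 0 := fun h => by
    have := he 2 (by omega)
    simp at this
  have hsq3 : e % 9 ≠ 0 := fun h => by
    have := he 3 (by omega)
    simp at this
  rw [ht] at hq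
  obtain ⟨p, rfl⟩ : (2 : ℤ) ∣ q := by
    have hq4 := sq_emod_four q
    have : 3 * q ^ 2 = 2 * (e * t) := by rw [hq]; ring
    omega
  obtain ⟨f, rfl⟩ : 2 ∣ e := by
    have : (2 : ℤ) ∣ e * t := ⟨3 * p ^ 2, by linarith⟩
    have := (Int.prime_two.dvd_or_dvd this).resolve_right (by omega)
    omega
  have hp : 3 * p ^ 2 = f * t := by
    push_cast at hq
    linarith
  have hfM : f ∣ M := (Dvd.intro_left 2 rfl).trans heM
  have hsf : Squarefree f := he.squarefree_of_dvd ⟨2, mul_comm 2 f⟩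
  by_cases h6 : M % 12 = 6
  · obtain ⟨g, rfl⟩ : 3 ∣ f := by
      have := three_dvd_of_three_mul_eq_mul hp (by omega)
      omega
    have hgt : p ^ 2 = g * t := by
      push_cast at hp
      linarith
    have h1 := emod_three_ne_two_of_sq_eq_mul hgt (ht3 h6)
    have h2 := emod_four_eq_of_sq_eq_mul hgt (by omega) (by omega)
    refine sq_ne_of_squarefree (hsf.squarefree_of_dvd ⟨3, mul_comm 3 g⟩) (by omega)
      (g := 2) (s := 2 * p) (c := c) (by norm_num)
      (Int.natCast_dvd_natCast.2 ((Dvd.intro_left 3 rfl).trans hfM)) ?_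
    rw [ht]
    linear_combination 4 * hgt
  · have h4 := emod_four_eq_of_sq_eq_mul (q := 3 * p) (f := f) (t := 3 * t)
      (by linear_combination 3 * hp) (by omega) (by omega)
    have hf : f % 12 = 5 ∨ f % 12 = 7 := by
      have hf3 := h3 (by omega)
      clear hq hp ht ht3 h3
      rcases ht4 with h | h <;> omega
    refine sq_ne_of_squarefree hsf hf
      (g := 6) (s := 6 * p) (c := c) (by norm_num) (Int.natCast_dvd_natCast.2 hfM) ?_
    rw [ht]
    linear_combination 12 * hp

theorem no_solution_of_M_mod_twelve (M : ℕ) (hM : 1 ≤ M)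
    (hmod : M % 12 = 3 ∨ M % 12 = 5 ∨ M % 12 = 6 ∨ M % 12 = 7 ∨ M % 12 = 8 ∨ M % 12 = 10) :
    ¬ ∃ a s : ℕ, 1 ≤ a ∧ 1 ≤ s ∧ ∑ i ∈ Finset.range M, (a + i) ^ 2 = s ^ 2 := by
  rintro ⟨a, s, -, -, hsum⟩
  obtain ⟨e, D, -, hD, hDe, he⟩ := Nat.sq_mul_squarefree_of_pos hM
  have key := twelve_mul_sum_consecutive_sq M a
  rw [hsum] at key
  push_cast at key
  have hDe' : (D : ℤ) ^ 2 * e = M := by exact_mod_cast hDe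
  obtain ⟨q, hq⟩ := exists_three_mul_sq_eq_of_sq_mul_eq (by positivity) hDe' key
  have heM : e ∣ M := ⟨_, by rw [← hDe, mul_comm]⟩
  have h3 : M % 3 ≠ 0 → e % 3 = M % 3 := fun h => by
    exact_mod_cast emod_three_of_sq_mul_eq hDe' (by exact_mod_cast h)
  have h4 : M % 4 ≠ 0 → e % 4 = M % 4 := fun h => by
    exact_mod_cast emod_four_of_sq_mul_eq hDe' (by exact_mod_cast h)
  clear hsum key hDe hDe'
  rcases Nat.mod_two_eq_zero_or_one M with h2 | h2
  · exact not_three_mul_sq_eq_of_even he heM h3 (by omega) (by omega) hq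
  · exact not_three_mul_sq_eq_of_odd he heM (h4 (by omega)) h3 (by omega) hq
end

section
/- If (M, a, s) is a solution with M ≡ 0 (mod 12), then M ≡ 0 (mod 72) or M ≡ 24 (mod 72). -/
theorem six_mul_sum_range_add_sq (n : ℕ) (a : ℤ) :
    6 * ∑ i ∈ Finset.range n, (a + i) ^ 2 =
      6 * n * a ^ 2 + 6 * a * n * (n - 1) + (n - 1) * n * (2 * n - 1) := by
  induction n with
  | zero => simp
  | succ k ih =>
    rw [Finset.sum_range_succ, mul_add, ih]
    push_cast
    ring

theorem Int.sq_emod_twelve (s : ℤ) :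
    s ^ 2 % 12 = 0 ∨ s ^ 2 % 12 = 1 ∨ s ^ 2 % 12 = 4 ∨ s ^ 2 % 12 = 9 := by
  have h : s % 12 = 0 ∨ s % 12 = 1 ∨ s % 12 = 2 ∨ s % 12 = 3 ∨ s % 12 = 4 ∨ s % 12 = 5 ∨
      s % 12 = 6 ∨ s % 12 = 7 ∨ s % 12 = 8 ∨ s % 12 = 9 ∨ s % 12 = 10 ∨ s % 12 = 11 := by
    omega
  rcases h with h | h | h | h | h | h | h | h | h | h | h | h <;> simp [pow_two, Int.mul_emod, h]

theorem solution_M_mod_zero (M a s : ℕ) (hM : 1 ≤ M) (ha : 1 ≤ a) (hs : 1 ≤ s)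
    (hsol : ∑ i ∈ Finset.range M, (a + i) ^ 2 = s ^ 2)
    (hmod : M % 12 = 0) :
    M % 72 = 0 ∨ M % 72 = 24 := by
  obtain ⟨m, rfl⟩ := Nat.dvd_of_mod_eq_zero hmod
  have hsum := six_mul_sum_range_add_sq (12 * m) a
  have hcast : ∑ i ∈ Finset.range (12 * m), ((a : ℤ) + i) ^ 2 = (s : ℤ) ^ 2 := by
    exact_mod_cast hsol
  rw [hcast] at hsum
  push_cast at hsum
  have hsq : (s : ℤ) ^ 2 =
      12 * (m * a ^ 2 + m * (12 * m - 1) * a + 48 * m ^ 3 - 6 * m ^ 2) + 2 * m := by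
    linarith
  have hres := Int.sq_emod_twelve s
  omega
end

section
/- If (M, a, s) is a solution with M > 1 and M ≡ 1 (mod 12), then M ≡ 1 (mod 24). -/
/-- Any `8 * j + 5` consecutive squares starting at `a ^ 2` sum to `a ^ 2 + 2` modulo `4`. -/
theorem sum_consecutive_sq_zmod_four (a j : ℕ) :
    ∑ i ∈ Finset.range (8 * j + 5), ((a + i : ℕ) : ZMod 4) ^ 2 = (a : ZMod 4) ^ 2 + 2 := by
  induction j with
  | zero =>
    simp only [Finset.sum_range_succ, Finset.sum_range_zero]
    push_cast
    generalize (a : ZMod 4) = x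
    revert x
    decide
  | succ j ih =>
    rw [show 8 * (j + 1) + 5 = (8 * j + 5) + 8 by ring, Finset.sum_range_add, ih]
    simp only [Finset.sum_range_succ, Finset.sum_range_zero]
    push_cast
    generalize (a : ZMod 4) = x
    generalize (j : ZMod 4) = y
    revert x y
    decide

theorem solution_M_mod_one (M a s : ℕ) (hM : 1 < M) (ha : 1 ≤ a) (hs : 1 ≤ s)
    (hsol : ∑ i ∈ Finset.range M, (a + i) ^ 2 = s ^ 2)
    (hmod : M % 12 = 1) :
    M % 24 = 1 := by
  by_contra h
  obtain ⟨j, rfl⟩ : ∃ j, M = 8 * j + 5 := ⟨M / 8, by omega⟩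
  have hcast := congrArg (Nat.cast : ℕ → ZMod 4) hsol
  rw [Nat.cast_sum] at hcast
  simp only [Nat.cast_pow] at hcast
  rw [sum_consecutive_sq_zmod_four] at hcast
  have hne : ∀ x y : ZMod 4, x ^ 2 + 2 ≠ y ^ 2 := by decide
  exact hne _ _ hcast
end

section
/- If (M, a, s) is a solution with M ≡ 2 (mod 12), then M ≡ 2 (mod 24). -/
/-- Two consecutive integers have squares summing to `1` modulo `4`, so `2 * n` consecutive
squares sum to `n` modulo `4`. -/
theorem sum_range_two_mul_sq_mod_four (a n : ℕ) :
    (∑ i ∈ Finset.range (2 * n), (a + i) ^ 2) % 4 = n % 4 := by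
  induction n with
  | zero => simp
  | succ n ih =>
    rw [show 2 * (n + 1) = 2 * n + 1 + 1 by ring, Finset.sum_range_succ, Finset.sum_range_succ]
    have key : ∀ b : ℕ, (b ^ 2 + (b + 1) ^ 2) % 4 = 1 := by
      intro b
      have hb : b % 4 < 4 := Nat.mod_lt _ (by norm_num)
      interval_cases h : b % 4 <;> simp [Nat.add_mod, Nat.pow_mod, h]
    have := key (a + 2 * n)
    rw [← add_assoc a (2 * n) 1]
    omega

theorem solution_M_mod_two (M a s : ℕ) (hM : 1 ≤ M) (ha : 1 ≤ a) (hs : 1 ≤ s)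
    (hsol : ∑ i ∈ Finset.range M, (a + i) ^ 2 = s ^ 2)
    (hmod : M % 12 = 2) :
    M % 24 = 2 := by
  obtain ⟨n, rfl⟩ : ∃ n, M = 2 * n := ⟨M / 2, by omega⟩
  have hn := sum_range_two_mul_sq_mod_four a n
  rw [hsol] at hn
  have hsq : s ^ 2 % 4 = 0 ∨ s ^ 2 % 4 = 1 := by
    have hb : s % 4 < 4 := Nat.mod_lt _ (by norm_num)
    interval_cases h : s % 4 <;> simp [Nat.pow_mod, h]
  omega
end

section
/- If (M, a, s) is a solution with M ≡ 4 (mod 12), then M ≡ 16 (mod 24). -/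
theorem sum_range_four_mul_sq_modEq (a n : ℕ) :
    ∑ i ∈ Finset.range (4 * n), (a + i) ^ 2 ≡ 2 * n [MOD 4] := by
  induction n with
  | zero => rfl
  | succ n ih =>
    have block (b : ℕ) : b ^ 2 + (b + 1) ^ 2 + (b + 2) ^ 2 + (b + 3) ^ 2 ≡ 2 [MOD 4] := by
      have h : b ^ 2 + (b + 1) ^ 2 + (b + 2) ^ 2 + (b + 3) ^ 2
          = 2 + 4 * (b ^ 2 + 3 * b + 3) := by ring
      rw [h]
      simp [Nat.ModEq]
    have h := ih.add (block (a + 4 * n))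
    rw [show 4 * (n + 1) = 4 * n + 1 + 1 + 1 + 1 by ring]
    simp only [Finset.sum_range_succ]
    convert h using 1 <;> ring

theorem solution_M_mod_four (M a s : ℕ) (hM : 1 ≤ M) (ha : 1 ≤ a) (hs : 1 ≤ s)
    (hsol : ∑ i ∈ Finset.range M, (a + i) ^ 2 = s ^ 2)
    (hmod : M % 12 = 4) :
    M % 24 = 16 := by
  by_contra hne
  obtain ⟨k, rfl⟩ : ∃ k, M = 4 * (6 * k + 1) := ⟨M / 24, by omega⟩
  have h := sum_range_four_mul_sq_modEq a (6 * k + 1)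
  rw [hsol, Nat.ModEq] at h
  have hsq : s ^ 2 % 4 = 0 ∨ s ^ 2 % 4 = 1 := by
    have : s % 4 = 0 ∨ s % 4 = 1 ∨ s % 4 = 2 ∨ s % 4 = 3 := by omega
    rcases this with h | h | h | h <;> simp [Nat.pow_mod, h]
  omega
end

section
/- If (M, a, s) is a solution with M > 1, then the residue of M modulo 72 lies in the set {0, 1, 2, 9, 11, 16, 23, 24, 25, 26, 33, 35, 40, 47, 49, 50, 59, 64, 71}. -/
theorem Nat.Prime.pow_mul_inj {p i j A B : ℕ} (hp : p.Prime) (hA : ¬ p ∣ A) (hB : ¬ p ∣ B)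
    (h : p ^ i * A = p ^ j * B) : i = j ∧ A = B := by
  have key : i = j := by
    rcases lt_trichotomy i j with hij | hij | hij
    · obtain ⟨k, rfl⟩ := Nat.exists_eq_add_of_lt hij
      rw [show i + k + 1 = i + (k + 1) by ring, pow_add, mul_assoc] at h
      have h' := Nat.eq_of_mul_eq_mul_left (pow_pos hp.pos i) h
      exact absurd ⟨p ^ k * B, by rw [h']; ring⟩ hA
    · exact hij
    · obtain ⟨k, rfl⟩ := Nat.exists_eq_add_of_lt hij
      rw [show j + k + 1 = j + (k + 1) by ring, pow_add, mul_assoc] at h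
      have h' := Nat.eq_of_mul_eq_mul_left (pow_pos hp.pos j) h
      exact absurd ⟨p ^ k * A, by rw [← h']; ring⟩ hB
  subst key
  exact ⟨rfl, Nat.eq_of_mul_eq_mul_left (pow_pos hp.pos i) h⟩

theorem Nat.Prime.mod_twelve_of_isSquare_three {p : ℕ} (hp : p.Prime) (h2 : p ≠ 2) (h3 : p ≠ 3)
    (h : IsSquare (3 : ZMod p)) : p % 12 = 1 ∨ p % 12 = 11 := by
  have := Fact.mk hp
  have hodd : p % 2 = 1 := hp.eq_two_or_odd.resolve_left h2
  have hp3 : p % 3 ≠ 0 := fun h0 =>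
    h3 ((Nat.prime_dvd_prime_iff_eq Nat.prime_three hp).1 (Nat.dvd_of_mod_eq_zero h0)).symm
  have hcast : ((p % 3 : ℕ) : ZMod 3) = (p : ZMod 3) := ZMod.natCast_mod p 3
  rcases (by omega : p % 4 = 1 ∨ p % 4 = 3) with h4 | h4
  · have hs : IsSquare (p : ZMod 3) :=
      (ZMod.exists_sq_eq_prime_iff_of_mod_four_eq_one (q := 3) h4 (by norm_num)).1
        (by exact_mod_cast h)
    have : p % 3 ≠ 2 := by
      intro h'
      rw [← hcast, h'] at hs
      revert hs
      decide
    omega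
  · have hs : ¬ IsSquare (p : ZMod 3) :=
      (ZMod.exists_sq_eq_prime_iff_of_mod_four_eq_three (q := 3) h4 (by norm_num) h3).1
        (by exact_mod_cast h)
    have : p % 3 ≠ 1 := by
      intro h'
      rw [← hcast, h'] at hs
      revert hs
      decide
    omega

theorem Nat.mod_twelve_of_forall_prime_dvd (n : ℕ) (h0 : n ≠ 0)
    (h : ∀ p, p.Prime → p ∣ n → p % 12 = 1 ∨ p % 12 = 11) : n % 12 = 1 ∨ n % 12 = 11 := by
  induction n using induction_on_primes with
  | zero => exact absurd rfl h0
  | one => simp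
  | prime_mul p a hp ih =>
    have h1 := h p hp (dvd_mul_right p a)
    have h2 := ih (right_ne_zero_of_mul h0) fun q hq hqa => h q hq (hqa.mul_left p)
    rcases h1 with h1 | h1 <;> rcases h2 with h2 | h2 <;> simp [Nat.mul_mod, h1, h2]

theorem Nat.mod_twelve_of_forall_odd_exponent {n : ℕ} (h2 : ¬ 2 ∣ n) (h3 : ¬ 3 ∣ n)
    (h : ∀ p e u, p.Prime → ¬ p ∣ u → n = p ^ e * u → Odd e → p % 12 = 1 ∨ p % 12 = 11) :
    n % 12 = 1 ∨ n % 12 = 11 := by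
  obtain ⟨a, b, hab, hsq⟩ := Nat.sq_mul_squarefree n
  have hn0 : n ≠ 0 := by rintro rfl; simp at h2
  have ha0 : a ≠ 0 := hsq.ne_zero
  have hb0 : b ≠ 0 := by rintro rfl; exact hn0 (by simp [← hab])
  have ha : a % 12 = 1 ∨ a % 12 = 11 := by
    refine Nat.mod_twelve_of_forall_prime_dvd a ha0 fun p hp hpa => ?_
    obtain ⟨c, rfl⟩ := hpa
    have hc : ¬ p ∣ c := by
      rintro ⟨d, rfl⟩
      exact hp.one_lt.ne' (Nat.isUnit_iff.1 (hsq p ⟨d, by ring⟩))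
    obtain ⟨j, d, hd, rfl⟩ := Nat.exists_eq_pow_mul_and_not_dvd hb0 p hp.ne_one
    refine h p (2 * j + 1) (d ^ 2 * c) hp ?_ (by rw [← hab]; ring) ⟨j, rfl⟩
    intro hdvd
    rcases hp.dvd_mul.1 hdvd with h' | h'
    · exact hd (hp.dvd_of_dvd_pow h')
    · exact hc h'
  have hb2 : ¬ 2 ∣ b := fun hd => h2 (hab ▸ (hd.pow two_ne_zero).mul_right a)
  have hb3 : ¬ 3 ∣ b := fun hd => h3 (hab ▸ (hd.pow two_ne_zero).mul_right a)
  have hb : b ^ 2 % 12 = 1 := by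
    have : b % 12 = 1 ∨ b % 12 = 5 ∨ b % 12 = 7 ∨ b % 12 = 11 := by omega
    rcases this with h | h | h | h <;> simp [Nat.pow_mod, h]
  rw [← hab, Nat.mul_mod, hb, one_mul, Nat.mod_mod]
  exact ha

theorem twelve_mul_sum_range_add_sq (M a : ℕ) :
    (12 * ∑ i ∈ Finset.range M, ((a : ℤ) + i) ^ 2) =
      M * (3 * (2 * a + M - 1) ^ 2 + M ^ 2 - 1) := by
  induction M with
  | zero => simp
  | succ n ih =>
    rw [Finset.sum_range_succ, mul_add, ih]
    push_cast
    ring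

/-- A prime `p ≥ 5` of odd exponent in `M` is `±1` modulo `12`
whenever `M * (3 * x ^ 2 + M ^ 2 - 1)` is `12` times a nonzero square. -/
theorem prime_mod_twelve_of_odd_exponent {M N x s p e u : ℕ} (hs : s ≠ 0)
    (hN : N + 1 = 3 * x ^ 2 + M ^ 2) (h : M * N = 12 * s ^ 2) (hp : p.Prime) (h2 : p ≠ 2)
    (h3 : p ≠ 3) (hu : ¬ p ∣ u) (hM : M = p ^ e * u) (he : Odd e) :
    p % 12 = 1 ∨ p % 12 = 11 := by
  obtain ⟨j, t, ht, rfl⟩ := Nat.exists_eq_pow_mul_and_not_dvd hs p hp.ne_one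
  have h12 : ¬ p ∣ 12 := by
    rw [show 12 = 2 ^ 2 * 3 by norm_num, hp.dvd_mul, not_or]
    exact ⟨fun hd => h2 ((Nat.prime_dvd_prime_iff_eq hp Nat.prime_two).1 (hp.dvd_of_dvd_pow hd)),
      fun hd => h3 ((Nat.prime_dvd_prime_iff_eq hp Nat.prime_three).1 hd)⟩
  have hpN : p ∣ N := by
    by_contra hpN
    have := (hp.pow_mul_inj (i := e) (j := 2 * j) (A := u * N) (B := 12 * t ^ 2)
      (by rw [hp.dvd_mul]; tauto)
      (by rw [hp.dvd_mul, not_or]; exact ⟨h12, fun hd => ht (hp.dvd_of_dvd_pow hd)⟩)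
      (by rw [← mul_assoc, ← hM, h]; ring)).1
    rw [this] at he
    exact Nat.not_odd_iff_even.2 (even_two_mul j) he
  have hpM : p ∣ M := hM ▸ (dvd_pow_self p he.pos.ne').mul_right u
  have := Fact.mk hp
  apply hp.mod_twelve_of_isSquare_three h2 h3
  have hc := congrArg (Nat.cast : ℕ → ZMod p) hN
  push_cast at hc
  rw [(ZMod.natCast_eq_zero_iff N p).2 hpN, (ZMod.natCast_eq_zero_iff M p).2 hpM] at hc
  exact ⟨3 * x, by linear_combination (3 : ZMod p) * hc⟩

theorem three_adic_condition {M N x s f u : ℕ} (hs : s ≠ 0)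
    (hN : N + 1 = 3 * x ^ 2 + M ^ 2) (h : M * N = 12 * s ^ 2) (hu : ¬ 3 ∣ u)
    (hM : M = 3 ^ f * u) (hf : f ≠ 0) : Odd f ∧ u % 3 = 2 := by
  obtain ⟨j, t, ht, rfl⟩ := Nat.exists_eq_pow_mul_and_not_dvd hs 3 (by norm_num)
  have h3M : 3 ∣ M := hM ▸ (dvd_pow_self 3 hf).mul_right u
  have hN3 : N % 3 = 2 := by
    obtain ⟨c, hc⟩ := h3M
    have : N + 1 = 3 * (x ^ 2 + 3 * c ^ 2) := by rw [hN, hc]; ring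
    omega
  have ht2 : t ^ 2 % 3 = 1 := by
    rcases (by omega : t % 3 = 1 ∨ t % 3 = 2) with h | h <;> simp [Nat.pow_mod, h]
  obtain ⟨h1, h2⟩ := Nat.prime_three.pow_mul_inj (i := f) (j := 2 * j + 1) (A := u * N)
    (B := 4 * t ^ 2) (by rw [Nat.prime_three.dvd_mul]; omega) (by omega)
    (by rw [← mul_assoc, ← hM, h]; ring)
  refine ⟨⟨j, h1⟩, ?_⟩
  have h3 : u * N % 3 = 1 := by omega
  rw [Nat.mul_mod, hN3] at h3
  omega

theorem two_adic_condition_even {M N x s e k : ℕ} (hs : s ≠ 0) (hx : x % 2 = 1)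
    (hN : N + 1 = 3 * x ^ 2 + M ^ 2) (h : M * N = 12 * s ^ 2) (hk : k % 2 = 1)
    (hM : M = 2 ^ e * k) (he : e ≠ 0) :
    Odd e ∧ (e = 1 → k % 4 = 1) ∧ (e ≠ 1 → k % 4 = 3) := by
  obtain ⟨j, t, ht, rfl⟩ := Nat.exists_eq_pow_mul_and_not_dvd hs 2 (by norm_num)
  have sq_mod : ∀ y : ℕ, y % 2 = 1 → y ^ 2 % 8 = 1 := fun y hy => by
    rcases (by omega : y % 8 = 1 ∨ y % 8 = 3 ∨ y % 8 = 5 ∨ y % 8 = 7) with h | h | h | h <;>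
      simp [Nat.pow_mod, h]
  have hx2 := sq_mod x hx
  have ht2 := sq_mod t (by omega)
  have hk2 := sq_mod k hk
  obtain ⟨c, rfl⟩ := Nat.exists_eq_succ_of_ne_zero he
  have hM2 : M ^ 2 = 4 * (2 ^ c * k) ^ 2 := by rw [hM, Nat.succ_eq_add_one]; ring
  obtain ⟨N', rfl⟩ : ∃ N', N = 2 * N' := ⟨N / 2, by omega⟩
  have hN' : N' % 2 = 1 := by omega
  obtain ⟨h1, h2⟩ := Nat.prime_two.pow_mul_inj (i := c + 2) (j := 2 * j + 2) (A := k * N')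
    (B := 3 * t ^ 2) (by rw [Nat.prime_two.dvd_mul]; omega) (by omega)
    (by rw [show 2 ^ (c + 2) * (k * N') = 2 ^ c.succ * k * (2 * N') by
          rw [Nat.succ_eq_add_one]; ring, ← hM, h]; ring)
  have hc : c = 2 * j := by omega
  have h3 : k * N' % 4 = 3 := by omega
  refine ⟨⟨j, by omega⟩, fun h1 => ?_, fun h1 => ?_⟩
  · obtain rfl : c = 0 := by omega
    have : N' % 4 = 3 := by
      rw [pow_zero, one_mul] at hM2
      omega
    rw [Nat.mul_mod, this] at h3
    omega
  · obtain ⟨d, rfl⟩ : ∃ d, c = d + 1 := ⟨c - 1, by omega⟩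
    have : N' % 4 = 1 := by
      have : M ^ 2 = 16 * (2 ^ d * k) ^ 2 := by rw [hM2]; ring
      omega
    rw [Nat.mul_mod, this] at h3
    omega

theorem two_adic_condition_odd {M N x s : ℕ} (hx : x % 2 = 0)
    (hN : N + 1 = 3 * x ^ 2 + M ^ 2) (h : M * N = 12 * s ^ 2) : M % 8 ≠ 5 := by
  intro h5
  obtain ⟨y, rfl⟩ : ∃ y, x = 2 * y := ⟨x / 2, by omega⟩
  obtain ⟨q, rfl⟩ : ∃ q, M = 8 * q + 5 := ⟨M / 8, by omega⟩
  have hN' : N = 4 * (3 * y ^ 2 + 16 * q ^ 2 + 20 * q + 6) := by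
    have : N + 1 = 4 * (3 * y ^ 2 + 16 * q ^ 2 + 20 * q + 6) + 1 := by rw [hN]; ring
    omega
  have h' : 4 * (2 * q * (3 * y ^ 2 + 16 * q ^ 2 + 20 * q + 6) + 3 * y ^ 2 + 20 * q ^ 2
      + 25 * q + 7) + 3 * y ^ 2 + 2 = 3 * s ^ 2 := by
    rw [hN'] at h
    linarith
  have sq_mod : ∀ y : ℕ, y ^ 2 % 4 = 0 ∨ y ^ 2 % 4 = 1 := fun y => by
    rcases (by omega : y % 4 = 0 ∨ y % 4 = 1 ∨ y % 4 = 2 ∨ y % 4 = 3) with h | h | h | h <;>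
      simp [Nat.pow_mod, h]
  have := sq_mod y
  have := sq_mod s
  omega

theorem solution_M_mod_seventytwo (M a s : ℕ) (hM : 1 < M) (ha : 1 ≤ a) (hs : 1 ≤ s)
    (hsol : ∑ i ∈ Finset.range M, (a + i) ^ 2 = s ^ 2) :
    M % 72 ∈ ({0, 1, 2, 9, 11, 16, 23, 24, 25, 26, 33, 35, 40, 47, 49, 50, 59, 64, 71} :
      Finset ℕ) := by
  obtain ⟨x, hx⟩ : ∃ x, x + 1 = 2 * a + M := ⟨2 * a + M - 1, by omega⟩
  obtain ⟨N, hN⟩ : ∃ N, N + 1 = 3 * x ^ 2 + M ^ 2 :=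
    ⟨3 * x ^ 2 + M ^ 2 - 1, by have := pow_pos (by omega : 0 < M) 2; omega⟩
  have h : M * N = 12 * s ^ 2 := by
    have h1 := twelve_mul_sum_range_add_sq M a
    have h2 := congrArg (Nat.cast : ℕ → ℤ) hsol
    have h3 := congrArg (Nat.cast : ℕ → ℤ) hx
    have h4 := congrArg (Nat.cast : ℕ → ℤ) hN
    push_cast at h2 h3 h4
    rw [h2, ← h3] at h1
    zify
    linear_combination (M : ℤ) * h4 - h1
  have hs0 : s ≠ 0 := by omega
  obtain ⟨e, k, hk, hMk⟩ := Nat.exists_eq_pow_mul_and_not_dvd (by omega : M ≠ 0) 2 (by norm_num)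
  have hk0 : k ≠ 0 := by rintro rfl; simp at hk
  obtain ⟨f, m, hm3, rfl⟩ := Nat.exists_eq_pow_mul_and_not_dvd hk0 3 (by norm_num)
  have hm2 : ¬ 2 ∣ m := fun hd => hk (hd.mul_left _)
  have hm : m % 12 = 1 ∨ m % 12 = 11 := by
    refine Nat.mod_twelve_of_forall_odd_exponent hm2 hm3 fun p i u hp hu hmu hi => ?_
    have hpm : p ∣ m := hmu ▸ (dvd_pow_self p hi.pos.ne').mul_right u
    have hp2 : p ≠ 2 := by rintro rfl; exact hm2 hpm
    have hp3 : p ≠ 3 := by rintro rfl; exact hm3 hpm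
    refine prime_mod_twelve_of_odd_exponent hs0 hN h hp hp2 hp3 (u := 2 ^ e * 3 ^ f * u) ?_
      (by rw [hMk, hmu]; ring) hi
    rw [hp.dvd_mul, hp.dvd_mul, not_or, not_or]
    exact ⟨⟨fun hd => hp2 ((Nat.prime_dvd_prime_iff_eq hp Nat.prime_two).1
        (hp.dvd_of_dvd_pow hd)),
      fun hd => hp3 ((Nat.prime_dvd_prime_iff_eq hp Nat.prime_three).1
        (hp.dvd_of_dvd_pow hd))⟩, hu⟩
  have h2e : ¬ 3 ∣ 2 ^ e := fun hd => by
    have := Nat.prime_three.dvd_of_dvd_pow hd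
    omega
  have three := three_adic_condition (f := f) (u := 2 ^ e * m) hs0 hN h
    (by rw [Nat.prime_three.dvd_mul]; tauto) (by rw [hMk]; ring)
  have odd_M : e = 0 → M % 8 ≠ 5 ∧ M = 3 ^ f * m := by
    rintro rfl
    rw [pow_zero, one_mul] at hMk
    exact ⟨two_adic_condition_odd (by omega) hN h, hMk⟩
  have even_M : e ≠ 0 → _ := fun he => two_adic_condition_even hs0
    (by have : 2 ∣ M := hMk ▸ (dvd_pow_self 2 he).mul_right _
        omega) hN h (by omega) hMk he
  have hfin : ∀ r < 72, r % 8 = 1 ∧ (r % 3 = 1 ∨ r % 9 = 0 ∨ r % 9 = 6) ∨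
      (r % 8 = 3 ∨ r % 8 = 7) ∧ r % 3 = 2 ∨ r % 8 = 2 ∧ r % 3 = 2 ∨
      r % 8 = 0 ∧ (r % 3 = 1 ∨ r % 9 = 0 ∨ r % 9 = 6) →
      r ∈ ({0, 1, 2, 9, 11, 16, 23, 24, 25, 26, 33, 35, 40, 47, 49, 50, 59, 64, 71} :
      Finset ℕ) := by decide
  refine hfin _ (Nat.mod_lt _ (by norm_num)) ?_
  rw [Nat.mod_mod_of_dvd M (by norm_num : 8 ∣ 72), Nat.mod_mod_of_dvd M (by norm_num : 3 ∣ 72),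
    Nat.mod_mod_of_dvd M (by norm_num : 9 ∣ 72)]
  have hm' : m % 4 = 1 ∧ m % 3 = 1 ∨ m % 4 = 3 ∧ m % 3 = 2 := by omega
  clear hfin hN hx h hsol hM ha hs hs0 hm hm2 hm3 h2e
  have two_pow : Odd e → 2 ^ e % 3 = 2 := by
    rintro ⟨j, rfl⟩
    simp [pow_succ, pow_mul, Nat.mul_mod, Nat.pow_mod]
  have eight_dvd : Odd e → e ≠ 1 → 8 ∣ M := by
    rintro ⟨j, rfl⟩ h1
    obtain ⟨i, rfl⟩ : ∃ i, j = i + 1 := ⟨j - 1, by omega⟩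
    exact ⟨2 ^ (2 * i) * (3 ^ f * m), by rw [hMk]; ring⟩
  rcases eq_or_ne f 0 with rfl | hf
  · rw [pow_zero, one_mul] at hMk odd_M even_M
    rcases eq_or_ne e 0 with he | he
    · obtain ⟨h5, hM'⟩ := odd_M he
      rw [← hM'] at hm'
      rcases hm' with ⟨h4, h3⟩ | ⟨h4, h3⟩
      · exact .inl ⟨by omega, .inl h3⟩
      · exact .inr (.inl ⟨by omega, h3⟩)
    · obtain ⟨ho, h1, h3⟩ := even_M he
      have hM3 : M % 3 = 2 * (m % 3) % 3 := by rw [hMk, Nat.mul_mod, two_pow ho]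
      rcases eq_or_ne e 1 with rfl | he1
      · have hm4 := h1 rfl
        have hm3 : m % 3 = 1 := by omega
        rw [hm3] at hM3
        exact .inr (.inr (.inl ⟨by omega, hM3⟩))
      · have hm4 := h3 he1
        have hm3 : m % 3 = 2 := by omega
        rw [hm3] at hM3
        exact .inr (.inr (.inr ⟨Nat.mod_eq_zero_of_dvd (eight_dvd ho he1), .inl hM3⟩))
  · obtain ⟨hfo, hu⟩ := three hf
    have hM9 : M % 9 = 0 ∨ M % 9 = 6 := by
      obtain ⟨j, rfl⟩ := hfo
      rcases j with _ | j
      · have : M = 3 * (2 ^ e * m) := by rw [hMk]; ring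
        clear hMk odd_M even_M hm' two_pow eight_dvd
        omega
      · left
        exact Nat.mod_eq_zero_of_dvd ⟨3 ^ (2 * j + 1) * (2 ^ e * m), by rw [hMk]; ring⟩
    have h34 : 3 ^ f * m % 4 = 3 * (m % 4) % 4 := by
      have h3f : 3 ^ f % 4 = 3 := by
        obtain ⟨j, rfl⟩ := hfo
        simp [pow_succ, pow_mul, Nat.mul_mod, Nat.pow_mod]
      rw [Nat.mul_mod, h3f]
    rcases eq_or_ne e 0 with rfl | he
    · rw [pow_zero, one_mul] at hu
      obtain ⟨h5, hM'⟩ := odd_M rfl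
      rw [← hM'] at h34
      exact .inl ⟨by omega, .inr hM9⟩
    · obtain ⟨ho, h1, h3⟩ := even_M he
      rw [Nat.mul_mod, two_pow ho] at hu
      rcases eq_or_ne e 1 with rfl | he1
      · have hk4 := h1 rfl
        have hm3 : m % 3 = 1 := by omega
        exfalso
        omega
      · exact .inr (.inr (.inr ⟨Nat.mod_eq_zero_of_dvd (eight_dvd ho he1), .inr hM9⟩))
end

section
/- If (M, a, s) is a solution with M ≡ 9 (mod 72), then s ≡ 0 (mod 6) when a is even and s ≡ 3 (mod 6) when a is odd; and if (M, a, s) is a solution with M ≡ 33 (mod 72), then s ≡ 2 or 4 (mod 6) when a is even and s ≡ 1 or 5 (mod 6) when a is odd. -/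
theorem six_mul_sum_range_consecutive_sq (M a : ℕ) :
    6 * ∑ i ∈ Finset.range (M + 1), (a + i) ^ 2 =
      6 * (M + 1) * a ^ 2 + 6 * a * (M + 1) * M + (M + 1) * M * (2 * M + 1) := by
  induction M with
  | zero => simp
  | succ n ih =>
    rw [Finset.sum_range_succ, mul_add, ih]
    ring

theorem sq_mod_six (n : ℕ) :
    (n % 6 = 0 ∧ n ^ 2 % 6 = 0) ∨ (n % 6 = 1 ∧ n ^ 2 % 6 = 1) ∨ (n % 6 = 2 ∧ n ^ 2 % 6 = 4) ∨
      (n % 6 = 3 ∧ n ^ 2 % 6 = 3) ∨ (n % 6 = 4 ∧ n ^ 2 % 6 = 4) ∨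
      (n % 6 = 5 ∧ n ^ 2 % 6 = 1) := by
  have h : n % 6 < 6 := Nat.mod_lt _ (by norm_num)
  rw [Nat.pow_mod]
  interval_cases n % 6 <;> simp

theorem solution_M_mod_nine_s_congruences (M a s : ℕ) (hM : 1 ≤ M) (ha : 1 ≤ a) (hs : 1 ≤ s)
    (hsol : ∑ i ∈ Finset.range M, (a + i) ^ 2 = s ^ 2) :
    (M % 72 = 9 → (Even a → s % 6 = 0) ∧ (Odd a → s % 6 = 3)) ∧
    (M % 72 = 33 → (Even a → s % 6 = 2 ∨ s % 6 = 4) ∧ (Odd a → s % 6 = 1 ∨ s % 6 = 5)) := by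
  have hs6 := sq_mod_six s
  have ha6 := sq_mod_six a
  simp only [Nat.even_iff, Nat.odd_iff]
  constructor
  · intro h
    obtain ⟨k, rfl⟩ : ∃ k, M = 72 * k + 8 + 1 := ⟨M / 72, by omega⟩
    have hsum := six_mul_sum_range_consecutive_sq (72 * k + 8) a
    rw [hsol] at hsum
    have key : s ^ 2 = 3 * a ^ 2 + 6 * ((12 * k + 1) * a ^ 2
        + 12 * a * (8 * k + 1) * (9 * k + 1)
        + 2 * (8 * k + 1) * (9 * k + 1) * (144 * k + 17)) := by
      linarith
    omega
  · intro h
    obtain ⟨k, rfl⟩ : ∃ k, M = 72 * k + 32 + 1 := ⟨M / 72, by omega⟩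
    have hsum := six_mul_sum_range_consecutive_sq (72 * k + 32) a
    rw [hsol] at hsum
    have key : s ^ 2 = 3 * a ^ 2 + 4 + 6 * ((12 * k + 5) * a ^ 2
        + 4 * a * (24 * k + 11) * (9 * k + 4)
        + (20736 * k ^ 3 + 28080 * k ^ 2 + 12674 * k + 1906)) := by
      linarith
    omega
end
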